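/- Define σ∞ = ⋃_{n} ⋃_{k,l ∈ {±1}^n} spec(A^{k,l}_fin) (eigenvalues of finite tridiagonal sign matrices) and π∞ = ⋃_{m} ⋃_{k,l ∈ {±1}^m} spec(A^{k,l}_per) (spectra of periodic tridiagonal sign operators on ℓ²(ℤ)). Then σ∞ ⊆ π∞ and π∞ ⊆ closure(σ∞); that is, σ∞ is a dense subset of π∞. -/

import Mathlib

open Complex Matrix

/-- The finite tridiagonal matrix `A^{k,l} ∈ ℂ^{(n+1)×(n+1)}` with subdiagonal entries
`k₁,…,kₙ` (here `k 0, …, k (n-1)`), superdiagonal entries `l₁,…,lₙ`, zeros elsewhere. -/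
def Afin (n : ℕ) (k l : ℕ → ℂ) : Matrix (Fin (n + 1)) (Fin (n + 1)) ℂ :=
  Matrix.of fun i j =>
    if (j : ℕ) = (i : ℕ) + 1 then l i else if (i : ℕ) = (j : ℕ) + 1 then k j else 0

/-- The set `σ∞` of all eigenvalues of finite tridiagonal sign matrices. -/
noncomputable def sigmaInf : Set ℂ :=
  {lam : ℂ | ∃ n : ℕ, 1 ≤ n ∧ ∃ k l : ℕ → ℂ,
    (∀ i < n, k i = 1 ∨ k i = -1) ∧ (∀ i < n, l i = 1 ∨ l i = -1) ∧
    lam ∈ spectrum ℂ (Afin n k l)}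

/-- The set `π∞` of all points in the spectra of periodic tridiagonal sign operators on
`ℓ²(ℤ)`: the operator determined by `m`-periodic sign sequences `k` (subdiagonal) and `l`
(superdiagonal) acts by `(A x)_j = l_{j mod m} x_{j+1} + k_{(j-1) mod m} x_{j-1}`. -/
noncomputable def piInf : Set ℂ :=
  {lam : ℂ | ∃ m : ℕ, 1 ≤ m ∧ ∃ k l : ℕ → ℂ,
    (∀ i < m, k i = 1 ∨ k i = -1) ∧ (∀ i < m, l i = 1 ∨ l i = -1) ∧
    ∃ T : lp (fun _ : ℤ => ℂ) 2 →L[ℂ] lp (fun _ : ℤ => ℂ) 2,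
      (∀ (x : lp (fun _ : ℤ => ℂ) 2) (j : ℤ),
        (T x : ∀ _ : ℤ, ℂ) j =
          l ((j % (m : ℤ)).toNat) * (x : ∀ _ : ℤ, ℂ) (j + 1) +
            k (((j - 1) % (m : ℤ)).toNat) * (x : ∀ _ : ℤ, ℂ) (j - 1)) ∧
      lam ∈ spectrum ℂ T}

namespace TridiagonalSign

open Polynomial

/-- One step of the transfer-matrix recursion `u (n + 2) = b * X • u (n + 1) - c • u n`. -/
noncomputable def step (b c : ℂ) : Matrix (Fin 2) (Fin 2) ℂ[X] :=
  !![C b * X, -C c; 1, 0]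

/-- The product of the first `n` transfer matrices. -/
noncomputable def transfer (b c : ℕ → ℂ) : ℕ → Matrix (Fin 2) (Fin 2) ℂ[X]
  | 0 => 1
  | n + 1 => step (b n) (c n) * transfer b c n

lemma det_step (b c : ℂ) : (step b c).det = C c := by
  simp [step, Matrix.det_fin_two]

lemma det_transfer (b c : ℕ → ℂ) (n : ℕ) :
    (transfer b c n).det = C (∏ i ∈ Finset.range n, c i) := by
  induction n with
  | zero => simp [transfer]
  | succ n ih =>
    rw [transfer, Matrix.det_mul, ih, det_step, Finset.prod_range_succ, map_mul, mul_comm]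

lemma transfer_succ' (b c : ℕ → ℂ) (n : ℕ) :
    transfer b c (n + 1) =
      transfer (fun i => b (i + 1)) (fun i => c (i + 1)) n * step (b 0) (c 0) := by
  induction n with
  | zero => simp [transfer]
  | succ n ih => rw [transfer, ih, transfer, Matrix.mul_assoc]

lemma trace_transfer_shift {b c : ℕ → ℂ} {m : ℕ} (hb : b m = b 0) (hc : c m = c 0)
    (h0 : c 0 ≠ 0) :
    (transfer (fun i => b (i + 1)) (fun i => c (i + 1)) m).trace = (transfer b c m).trace := by
  have h := transfer_succ' b c m
  rw [transfer, hb, hc] at h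
  have hC : (C (c 0) : ℂ[X]) ≠ 0 := by simpa using h0
  refine mul_left_cancel₀ hC ?_
  rw [← det_step (b 0) (c 0), ← smul_eq_mul, ← smul_eq_mul, ← Matrix.trace_smul,
    ← Matrix.trace_smul]
  have h1 : (step (b 0) (c 0)).det • transfer (fun i => b (i + 1)) (fun i => c (i + 1)) m =
      step (b 0) (c 0) * transfer b c m * (step (b 0) (c 0)).adjugate := by
    rw [h, Matrix.mul_assoc, Matrix.mul_adjugate, Matrix.mul_smul, Matrix.mul_one]
  rw [h1, Matrix.trace_mul_comm, ← Matrix.mul_assoc, Matrix.adjugate_mul, Matrix.smul_mul,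
    Matrix.one_mul]

lemma degree_transfer {b : ℕ → ℂ} (c : ℕ → ℂ) (hb : ∀ n, b n ≠ 0) (n : ℕ) :
    (transfer b c n 0 0).degree = n ∧ (transfer b c n 1 0).degree < n ∧
      (transfer b c n 0 1).degree < n ∧ (transfer b c n 1 1).degree < (n + 1 : ℕ) := by
  induction n with
  | zero => simp [transfer]
  | succ n ih =>
    obtain ⟨h1, h2, h3, h4⟩ := ih
    have hcmul (a : ℂ) (p : ℂ[X]) : (C a * p).degree ≤ p.degree := by
      rw [← smul_eq_C_mul]; exact degree_smul_le a p
    have hlt : (n : WithBot ℕ) < ((n + 1 : ℕ) : WithBot ℕ) := by exact_mod_cast n.lt_succ_self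
    have h1' : (C (b n) * X * transfer b c n 0 0).degree = ((n + 1 : ℕ) : WithBot ℕ) := by
      rw [mul_assoc, degree_C_mul (hb n), degree_mul, h1, degree_X, add_comm]; norm_cast
    have h3' : (C (b n) * X * transfer b c n 0 1).degree < ((n + 1 : ℕ) : WithBot ℕ) := by
      rw [mul_assoc, degree_C_mul (hb n), degree_mul, degree_X, add_comm]
      push_cast
      exact WithBot.add_lt_add_right (by simp) h3
    simp only [transfer, step, Matrix.mul_apply, Fin.sum_univ_two, Matrix.of_apply,
      Matrix.cons_val', Matrix.cons_val_zero, Matrix.cons_val_one, Matrix.cons_val_fin_one,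
      one_mul, zero_mul, add_zero, neg_mul, ← sub_eq_add_neg]
    refine ⟨?_, ?_, ?_, ?_⟩
    · rw [degree_sub_eq_left_of_degree_lt, h1']
      rw [h1']
      exact ((hcmul _ _).trans_lt h2).trans hlt
    · rw [h1]; exact hlt
    · exact (degree_sub_le _ _).trans_lt (max_lt h3' ((hcmul _ _).trans_lt h4))
    · exact h3.trans (by exact_mod_cast (by omega : n < n + 1 + 1))

lemma degree_trace_transfer {b : ℕ → ℂ} (c : ℕ → ℂ) (hb : ∀ n, b n ≠ 0) {m : ℕ} (hm : 1 ≤ m) :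
    (transfer b c m).trace.degree = m := by
  obtain ⟨n, rfl⟩ : ∃ n, m = n + 1 := ⟨m - 1, by omega⟩
  rw [Matrix.trace_fin_two]
  have h := (degree_transfer c hb (n + 1)).1
  rw [degree_add_eq_left_of_degree_lt, h]
  rw [h]
  have h1 : transfer b c (n + 1) 1 1 = transfer b c n 0 1 := by
    simp [transfer, step, Matrix.mul_apply, Fin.sum_univ_two]
  rw [h1]
  exact (degree_transfer c hb n).2.2.1.trans (by exact_mod_cast n.lt_succ_self)

lemma recursion_eq_transfer {b c : ℕ → ℂ} (L : ℕ → ℂ[X] →+ ℂ)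
    (hL : ∀ n p, L (n + 2) p = L (n + 1) (C (b n) * X * p) - L n (C (c n) * p)) (n : ℕ) :
    (∀ p, L (n + 1) p = L 1 (transfer b c n 0 0 * p) + L 0 (transfer b c n 0 1 * p)) ∧
      ∀ p, L n p = L 1 (transfer b c n 1 0 * p) + L 0 (transfer b c n 1 1 * p) := by
  induction n with
  | zero => simp [transfer]
  | succ n ih =>
    obtain ⟨h1, h2⟩ := ih
    refine ⟨fun p => ?_, fun p => ?_⟩
    · rw [hL, h1, h2, add_sub_add_comm, ← map_sub, ← map_sub]
      simp only [transfer, step, Matrix.mul_apply, Fin.sum_univ_two, Matrix.of_apply,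
        Matrix.cons_val', Matrix.cons_val_zero, Matrix.cons_val_one, Matrix.cons_val_fin_one]
      congr 2 <;> ring
    · rw [h1]
      simp [transfer, step, Matrix.mul_apply, Fin.sum_univ_two]

/-- Cayley–Hamilton for the transfer matrix over one period. -/
lemma recursion_two_mul_period {b c : ℕ → ℂ} {m : ℕ} (hb : ∀ n, b (n + m) = b n)
    (hc : ∀ n, c (n + m) = c n) (L : ℕ → ℂ[X] →+ ℂ)
    (hL : ∀ n p, L (n + 2) p = L (n + 1) (C (b n) * X * p) - L n (C (c n) * p)) (p : ℂ[X]) :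
    L (2 * m) p = L m ((transfer b c m).trace * p) -
      L 0 (C (∏ i ∈ Finset.range m, c i) * p) := by
  have h := recursion_eq_transfer L hL m
  have h' := recursion_eq_transfer (b := b) (c := c) (fun n => L (n + m)) (fun n q => by
    have := hL (n + m) q
    rw [hb, hc] at this
    convert this using 2
    · congr 1; ring
    · congr 2; ring) m
  have h2 := h'.2 p
  simp only [zero_add, add_comm 1 m] at h2
  have h3 := h.2 (transfer b c m 0 0 * p)
  rw [two_mul, h2, h.1, ← det_transfer b c m, Matrix.det_fin_two, Matrix.trace_fin_two, add_mul,
    map_add, sub_mul, map_sub, h3]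
  ring_nf

/-- The Hilbert space `ℓ²(ℤ)`. -/
noncomputable abbrev EllTwo : Type := lp (fun _ : ℤ => ℂ) 2

lemma memℓp_weighted_shift (s : ℤ → ℂ) (hs : ∀ j, ‖s j‖ = 1) (a : ℤ) (x : EllTwo) :
    Memℓp (fun j : ℤ => s j * x (j + a)) 2 := by
  have h : (0 : ℝ) < (2 : ENNReal).toReal := by simp
  refine memℓp_gen ?_
  simp only [norm_mul, hs, one_mul]
  exact (Equiv.addRight a).summable_iff.mpr ((lp.memℓp x).summable h)

/-- The weighted shift `x ↦ (s j * x (j + a))` with unimodular weights. -/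
noncomputable def weightedShift (s : ℤ → ℂ) (hs : ∀ j, ‖s j‖ = 1) (a : ℤ) :
    EllTwo →ₗᵢ[ℂ] EllTwo where
  toFun x := ⟨fun j => s j * x (j + a), memℓp_weighted_shift s hs a x⟩
  map_add' x y := by
    ext j
    exact mul_add (s j) _ _
  map_smul' r x := by
    ext j
    exact mul_left_comm (s j) r _
  norm_map' x := by
    have h : (0 : ℝ) < (2 : ENNReal).toReal := by simp
    refine (Real.rpow_left_inj (norm_nonneg _) (norm_nonneg _) h.ne').1 ?_
    rw [lp.norm_rpow_eq_tsum h, lp.norm_rpow_eq_tsum h]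
    refine Eq.trans ?_ ((Equiv.addRight a).tsum_eq fun i => ‖x i‖ ^ (2 : ENNReal).toReal)
    simp [hs]

@[simp]
lemma weightedShift_apply (s : ℤ → ℂ) (hs : ∀ j, ‖s j‖ = 1) (a : ℤ) (x : EllTwo) (j : ℤ) :
    weightedShift s hs a x j = s j * x (j + a) := rfl

/-- The bilateral shift by `a` as a linear isometric equivalence of `ℓ²(ℤ)`. -/
noncomputable def shift (a : ℤ) : EllTwo ≃ₗᵢ[ℂ] EllTwo where
  toLinearEquiv := LinearEquiv.ofLinearMap
    (weightedShift (fun _ => 1) (by simp) a).toLinearMap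
    (weightedShift (fun _ => 1) (by simp) (-a)).toLinearMap
    (by ext x j; simp) (by ext x j; simp)
  norm_map' x := (weightedShift (fun _ => 1) (by simp) a).norm_map x

@[simp]
lemma shift_apply (a : ℤ) (x : EllTwo) (j : ℤ) : shift a x j = x (j + a) := by
  change (1 : ℂ) * x (j + a) = _
  rw [one_mul]

lemma isUnit_linearIsometryEquiv_sub {H : Type*} [NormedAddCommGroup H]
    [InnerProductSpace ℂ H] [CompleteSpace H] (U : H ≃ₗᵢ[ℂ] H) {μ : ℂ} (hμ : ‖μ‖ ≠ 1) :
    IsUnit ((U : H →L[ℂ] H) - algebraMap ℂ (H →L[ℂ] H) μ) := by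
  have h : μ ∉ spectrum ℂ (U : H →L[ℂ] H) := fun hmem => by
    have hU : ((Unitary.linearIsometryEquiv.symm U : unitary (H →L[ℂ] H)) : H →L[ℂ] H) = U := rfl
    rw [← hU] at hmem
    have := Unitary.spectrum_subset_circle _ hmem
    exact hμ (by simpa using this)
  rw [spectrum.notMem_iff] at h
  rw [← neg_sub]
  exact h.neg

/-- The spectrum of `S + d S⁻¹`, where `S` is the shift by `m`, is covered by the symbol curve. -/
lemma exists_unimodular_of_mem_spectrum {m : ℤ} {d w : ℂ} (hd : ‖d‖ = 1)
    {Q : EllTwo →L[ℂ] EllTwo} (hQ : ∀ (x : EllTwo) (j : ℤ), Q x j = x (j + m) + d * x (j - m))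
    (hw : w ∈ spectrum ℂ Q) : ∃ μ : ℂ, ‖μ‖ = 1 ∧ w = μ + d / μ := by
  have hd0 : d ≠ 0 := by rintro rfl; simp at hd
  obtain ⟨s, hs⟩ := IsAlgClosed.exists_pow_nat_eq (w ^ 2 - 4 * d) (by norm_num : 0 < 2)
  set μ := (w + s) / 2 with hμ
  have hq : μ * (w - μ) = d := by
    rw [hμ]; linear_combination (-1 / 4 : ℂ) * hs
  have hμ0 : μ ≠ 0 := by rintro h; rw [h, zero_mul] at hq; exact hd0 hq.symm
  have hw' : d / μ = w - μ := by rw [← hq]; field_simp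
  refine ⟨μ, ?_, by rw [hw']; ring⟩
  by_contra hne
  have hne' : ‖w - μ‖ ≠ 1 := by
    rw [← hw', norm_div, hd]
    intro h
    have : ‖μ‖ ≠ 0 := by simpa using hμ0
    field_simp at h
    exact hne h.symm
  refine spectrum.mem_iff.1 hw ?_
  rw [← IsUnit.neg_iff, neg_sub]
  set S : EllTwo →L[ℂ] EllTwo := (shift m : EllTwo →L[ℂ] EllTwo) with hSdef
  set S' : EllTwo →L[ℂ] EllTwo := (shift (-m) : EllTwo →L[ℂ] EllTwo) with hSdef'
  have hS (x : EllTwo) (j : ℤ) : S x j = x (j + m) := shift_apply m x j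
  have hS' (x : EllTwo) (j : ℤ) : S' x j = x (j - m) := shift_apply (-m) x j
  have hsub (ν : ℂ) (x : EllTwo) (j : ℤ) :
      (S - algebraMap ℂ (EllTwo →L[ℂ] EllTwo) ν) x j = x (j + m) - ν * x j := by
    rw [← hS]; rfl
  have hfac : Q - algebraMap ℂ (EllTwo →L[ℂ] EllTwo) w =
      S' * ((S - algebraMap ℂ (EllTwo →L[ℂ] EllTwo) μ) *
          (S - algebraMap ℂ (EllTwo →L[ℂ] EllTwo) (w - μ))) := by
    ext x j
    have h1 : (Q - algebraMap ℂ (EllTwo →L[ℂ] EllTwo) w) x j = Q x j - w * x j := rfl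
    have h2 (x : EllTwo) : (S' * ((S - algebraMap ℂ (EllTwo →L[ℂ] EllTwo) μ) *
        (S - algebraMap ℂ (EllTwo →L[ℂ] EllTwo) (w - μ)))) x =
      S' ((S - algebraMap ℂ (EllTwo →L[ℂ] EllTwo) μ)
        ((S - algebraMap ℂ (EllTwo →L[ℂ] EllTwo) (w - μ)) x)) := rfl
    rw [h1, hQ, h2, hS', hsub, hsub, hsub, ← hq, sub_add_cancel]
    ring
  rw [hfac]
  refine IsUnit.mul ?_ ((isUnit_linearIsometryEquiv_sub _ hne).mul
    (isUnit_linearIsometryEquiv_sub _ hne'))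
  have h0 := isUnit_linearIsometryEquiv_sub (shift (-m)) (μ := 0) (by simp)
  rwa [map_zero, sub_zero] at h0

/-- The discriminant (trace of the transfer matrix over a period) of the periodic operator
`(T x) j = B j * x (j + 1) + K (j - 1) * x (j - 1)`, computed from the base point `e`. -/
noncomputable def discriminant (B K : ℤ → ℂ) (m : ℕ) (e : ℤ) : ℂ[X] :=
  (transfer (fun n => B (e + n)) (fun n => B (e + n) * K (e + n - 1)) m).trace

lemma int_const_of_succ {α : Type*} {f : ℤ → α} (h : ∀ e, f (e + 1) = f e) (e : ℤ) :
    f e = f 0 := by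
  induction e with
  | zero => rfl
  | succ i ih => rw [h, ih]
  | pred i ih => rw [← h, sub_add_cancel, ih]

lemma discriminant_eq {B K : ℤ → ℂ} {m : ℕ} (hB : ∀ j, B (j + m) = B j)
    (hK : ∀ j, K (j + m) = K j) (hB0 : ∀ j, B j ≠ 0) (hK0 : ∀ j, K j ≠ 0) (e : ℤ) :
    discriminant B K m e = discriminant B K m 0 := by
  refine int_const_of_succ (f := discriminant B K m) (fun e => ?_) e
  have hK' : K (e + m - 1) = K (e - 1) := by rw [← hK (e - 1)]; congr 1; ring
  have h := trace_transfer_shift (b := fun n : ℕ => B (e + n))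
    (c := fun n : ℕ => B (e + n) * K (e + n - 1)) (m := m) (by simp [hB]) (by simp [hB, hK'])
    (mul_ne_zero (hB0 _) (hK0 _))
  have hs (n : ℕ) : e + 1 + n = e + (n + 1 : ℕ) := by push_cast; ring
  simp only [discriminant, hs]
  exact h

lemma prod_window_eq {f : ℤ → ℂ} {m : ℕ} (hf : ∀ j, f (j + m) = f j) (hf0 : ∀ j, f j ≠ 0)
    (e : ℤ) : ∏ i ∈ Finset.range m, f (e + i) = ∏ i ∈ Finset.range m, f (0 + i) := by
  refine int_const_of_succ (f := fun e => ∏ i ∈ Finset.range m, f (e + i)) (fun e => ?_) e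
  have h := Finset.prod_range_succ (fun i : ℕ => f (e + i)) m
  rw [Finset.prod_range_succ', hf] at h
  simp only [Nat.cast_zero, add_zero] at h
  refine Eq.trans ?_ (mul_right_cancel₀ (hf0 e) h)
  refine Finset.prod_congr rfl fun i _ => ?_
  push_cast
  congr 1
  ring

/-- The discriminant of a periodic operator, evaluated at the operator, is `S + d S⁻¹`. -/
lemma aeval_discriminant {B K : ℤ → ℂ} {m : ℕ} (hB : ∀ j, B (j + m) = B j)
    (hK : ∀ j, K (j + m) = K j) (hB1 : ∀ j, B j * B j = 1) (hK0 : ∀ j, K j ≠ 0)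
    {T : EllTwo →L[ℂ] EllTwo}
    (hT : ∀ (x : EllTwo) (j : ℤ), T x j = B j * x (j + 1) + K (j - 1) * x (j - 1))
    (x : EllTwo) (j : ℤ) :
    aeval T (discriminant B K m 0) x j =
      x (j + m) + (∏ i ∈ Finset.range m, B (0 + i) * K (0 + i - 1)) * x (j - m) := by
  have hB0 (j : ℤ) : B j ≠ 0 := fun h => by simpa [h] using hB1 j
  have hK' (j : ℤ) : K (j + m - 1) = K (j - 1) := by rw [← hK (j - 1)]; congr 1; ring
  set e : ℤ := j - m + 1 with he
  rw [← discriminant_eq hB hK hB0 hK0 e,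
    ← prod_window_eq (f := fun j => B j * K (j - 1)) (fun j => by rw [hB, hK'])
      (fun j => mul_ne_zero (hB0 _) (hK0 _)) e]
  have hmulC (a : ℂ) (p : ℂ[X]) (i : ℤ) : aeval T (C a * p) x i = a * aeval T p x i := by
    rw [← smul_eq_C_mul, map_smul]; rfl
  have hmulX (p : ℂ[X]) (i : ℤ) : aeval T (X * p) x i =
      B i * aeval T p x (i + 1) + K (i - 1) * aeval T p x (i - 1) := by
    rw [map_mul, aeval_X, ← hT]; rfl
  have h := recursion_two_mul_period (b := fun n : ℕ => B (e + n))
    (c := fun n : ℕ => B (e + n) * K (e + n - 1)) (m := m)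
    (fun n => by rw [Nat.cast_add, ← add_assoc, hB])
    (fun n => by rw [Nat.cast_add, ← add_assoc, hB, hK'])
    (fun n => AddMonoidHom.mk' (fun p => aeval T p x (e - 1 + n))
      (fun p q => by rw [map_add]; rfl))
    (fun n p => by
      simp only [AddMonoidHom.mk'_apply]
      rw [mul_assoc, hmulC, hmulX, hmulC]
      push_cast
      rw [show e - 1 + ((n : ℤ) + 1) = e + n by ring, show e - 1 + ((n : ℤ) + 2) = e + n + 1 by ring,
        show e - 1 + (n : ℤ) = e + n - 1 by ring]
      linear_combination (-aeval T p x (e + n + 1)) * hB1 (e + n))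
    1
  simp only [AddMonoidHom.mk'_apply] at h
  rw [hmulC, mul_one, map_one] at h
  push_cast at h
  rw [show e - 1 + 2 * (m : ℤ) = j + m by rw [he]; ring, show e - 1 + (m : ℤ) = j by rw [he]; ring,
    show e - 1 + 0 = j - (m : ℤ) by rw [he]; ring] at h
  simp only [id] at h
  rw [h, discriminant, sub_add_cancel]

/-- Points of the spectrum of a periodic sign operator are mapped to the symbol curve by the
discriminant. -/
lemma exists_unimodular_eval_discriminant {B K : ℤ → ℂ} {m : ℕ} (hB : ∀ j, B (j + m) = B j)
    (hK : ∀ j, K (j + m) = K j) (hB1 : ∀ j, B j = 1 ∨ B j = -1) (hK1 : ∀ j, K j = 1 ∨ K j = -1)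
    {T : EllTwo →L[ℂ] EllTwo}
    (hT : ∀ (x : EllTwo) (j : ℤ), T x j = B j * x (j + 1) + K (j - 1) * x (j - 1))
    {lam : ℂ} (hlam : lam ∈ spectrum ℂ T) :
    ∃ μ : ℂ, ‖μ‖ = 1 ∧ (discriminant B K m 0).eval lam =
      μ + (∏ i ∈ Finset.range m, B (0 + i) * K (0 + i - 1)) / μ := by
  have hBn (j : ℤ) : ‖B j‖ = 1 := by rcases hB1 j with h | h <;> simp [h]
  have hKn (j : ℤ) : ‖K j‖ = 1 := by rcases hK1 j with h | h <;> simp [h]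
  refine exists_unimodular_of_mem_spectrum (m := m) (by simp [norm_prod, hBn, hKn])
    (aeval_discriminant hB hK (fun j => by rcases hB1 j with h | h <;> simp [h])
      (fun j => by rcases hK1 j with h | h <;> simp [h]) hT) ?_
  exact spectrum.subset_polynomial_aeval T _ ⟨lam, hlam, rfl⟩

lemma afin_mulVec {n : ℕ} (k l u : ℕ → ℂ) (h0 : u 0 = 0) (hn : u (n + 2) = 0)
    (i : Fin (n + 1)) :
    (Afin n k l *ᵥ fun j : Fin (n + 1) => u (j + 1)) i = l i * u (i + 2) + k (i - 1) * u i := by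
  have hi := i.isLt
  have hentry (j : ℕ) : (if j = (i : ℕ) + 1 then l i else if (i : ℕ) = j + 1 then k j else 0) *
      u (j + 1) = (if j = (i : ℕ) + 1 then l i * u (j + 1) else 0) +
        if (i : ℕ) = j + 1 then k j * u (j + 1) else 0 := by
    split_ifs <;> first | omega | simp
  simp only [Matrix.mulVec, dotProduct, Afin, Matrix.of_apply]
  rw [Fin.sum_univ_eq_sum_range (fun j : ℕ =>
    (if j = (i : ℕ) + 1 then l i else if (i : ℕ) = j + 1 then k j else 0) * u (j + 1)) (n + 1)]
  simp only [hentry]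
  rw [Finset.sum_add_distrib, Finset.sum_ite_eq']
  congr 1
  · split_ifs with h
    · rfl
    · have : (i : ℕ) + 2 = n + 2 := by simp at h; omega
      rw [this, hn, mul_zero]
  · rcases Nat.eq_zero_or_pos (i : ℕ) with h | h
    · rw [h, h0, mul_zero]
      exact Finset.sum_eq_zero fun j _ => by simp
    · rw [Finset.sum_eq_single ((i : ℕ) - 1)]
      · rw [if_pos (by omega), Nat.sub_add_cancel h]
      · intro j _ hj
        rw [if_neg (by omega)]
      · intro h'
        simp at h'

/-- Eigenvalues of `Afin n k l` are the `lam` for which the three-term recursion has a nontrivial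
solution vanishing at `0` and `n + 2`. -/
lemma mem_spectrum_afin_iff {n : ℕ} {k l : ℕ → ℂ} {lam : ℂ} :
    lam ∈ spectrum ℂ (Afin n k l) ↔ ∃ u : ℕ → ℂ, u 0 = 0 ∧ u (n + 2) = 0 ∧
      (∃ i ≤ n, u (i + 1) ≠ 0) ∧
      ∀ i ≤ n, l i * u (i + 2) + k (i - 1) * u i = lam * u (i + 1) := by
  rw [← Matrix.spectrum_toLin', ← Module.End.hasEigenvalue_iff_mem_spectrum]
  constructor
  · intro h
    obtain ⟨v, hv⟩ := h.exists_hasEigenvector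
    set u : ℕ → ℂ := fun j => if h : 1 ≤ j ∧ j ≤ n + 1 then v ⟨j - 1, by omega⟩ else 0 with hu
    have hv' : v = fun j : Fin (n + 1) => u (j + 1) := by
      ext j
      have := j.isLt
      simp only [hu]
      rw [dif_pos (by omega)]
      rfl
    have h0 : u 0 = 0 := by simp [hu]
    have hn : u (n + 2) = 0 := by simp [hu]
    refine ⟨u, h0, hn, ?_, fun i hi => ?_⟩
    · by_contra! hcon
      exact hv.2 (hv'.trans (funext fun j => hcon j (by omega)))
    · rw [← afin_mulVec k l u h0 hn ⟨i, by omega⟩, ← hv', ← Matrix.toLin'_apply, hv.apply_eq_smul,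
        hv']
      rfl
  · rintro ⟨u, h0, hn, ⟨i, hi, hne⟩, hrec⟩
    refine Module.End.hasEigenvalue_of_hasEigenvector
      (x := fun j : Fin (n + 1) => u (j + 1)) ⟨?_, fun h => hne ?_⟩
    · rw [Module.End.mem_eigenspace_iff, Matrix.toLin'_apply]
      ext j
      rw [afin_mulVec k l u h0 hn j, hrec j (by omega)]
      rfl
    · exact congrFun h ⟨i, by omega⟩

/-- The solution of `u (n + 2) = b n * lam * u (n + 1) - c n * u n` with `u 0 = 0`, `u 1 = 1`. -/
noncomputable def solution (b c : ℕ → ℂ) (lam : ℂ) : ℕ → ℂ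
  | 0 => 0
  | 1 => 1
  | n + 2 => b n * lam * solution b c lam (n + 1) - c n * solution b c lam n

lemma solution_two_periods {b c : ℕ → ℂ} {m : ℕ} (hb : ∀ n, b (n + m) = b n)
    (hc : ∀ n, c (n + m) = c n) (lam : ℂ) (r : ℕ) :
    solution b c lam ((r + 2) * m) =
      (transfer b c m).trace.eval lam * solution b c lam ((r + 1) * m) -
        (∏ i ∈ Finset.range m, c i) * solution b c lam (r * m) := by
  have hbr (n : ℕ) : b (n + r * m) = b n := Function.Periodic.nat_mul hb r n
  have hcr (n : ℕ) : c (n + r * m) = c n := Function.Periodic.nat_mul hc r n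
  have h := recursion_two_mul_period hb hc
    (fun n => AddMonoidHom.mk' (fun p : ℂ[X] => p.eval lam * solution b c lam (n + r * m))
      (fun p q => by rw [eval_add, add_mul]))
    (fun n p => by
      simp only [AddMonoidHom.mk'_apply, eval_mul, eval_C, eval_X]
      rw [show n + 2 + r * m = n + r * m + 2 by ring, solution, hbr, hcr,
        show n + r * m + 1 = n + 1 + r * m by ring]
      ring) 1
  simp only [AddMonoidHom.mk'_apply, eval_C, eval_one, one_mul, mul_one, zero_add] at h
  rw [show (r + 2) * m = 2 * m + r * m by ring, show (r + 1) * m = m + r * m by ring, h]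

/-- If the discriminant is `μ + d / μ`, the solution vanishes after `N` periods whenever
`μ ^ N = (d / μ) ^ N` and `μ ≠ d / μ`. -/
lemma solution_eq_zero {b c : ℕ → ℂ} {m : ℕ} (hb : ∀ n, b (n + m) = b n)
    (hc : ∀ n, c (n + m) = c n) {lam μ ν : ℂ} (hτ : (transfer b c m).trace.eval lam = μ + ν)
    (hd : ∏ i ∈ Finset.range m, c i = μ * ν) (hne : μ ≠ ν) {N : ℕ} (hN : μ ^ N = ν ^ N) :
    solution b c lam (N * m) = 0 := by
  have key (r : ℕ) : (μ - ν) * solution b c lam (r * m) =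
      (μ ^ r - ν ^ r) * solution b c lam m ∧
      (μ - ν) * solution b c lam ((r + 1) * m) =
        (μ ^ (r + 1) - ν ^ (r + 1)) * solution b c lam m := by
    induction r with
    | zero => simp [solution]
    | succ r ih =>
      refine ⟨ih.2, ?_⟩
      rw [solution_two_periods hb hc, hτ, hd]
      linear_combination (μ + ν) * ih.2 - μ * ν * ih.1
  have h := (key N).1
  rw [hN, sub_self, zero_mul] at h
  exact (mul_eq_zero.1 h).resolve_left (sub_ne_zero.2 hne)

lemma exists_rootOfUnity_near {d μ : ℂ} (hd : d = 1 ∨ d = -1) (hμ : ‖μ‖ = 1) {W : Set ℂ}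
    (hW : IsOpen W) (hmem : μ + d / μ ∈ W) :
    ∃ (ν : ℂ) (N : ℕ), 4 ≤ N ∧ ν ≠ 0 ∧ ν ≠ d / ν ∧ ν ^ N = (d / ν) ^ N ∧ ν + d / ν ∈ W := by
  set E : ℝ → ℂ := fun s => Complex.exp (Real.pi * s * Complex.I) with hE
  have hE0 (s : ℝ) : E s ≠ 0 := Complex.exp_ne_zero _
  have hEc : Continuous E := by fun_prop
  have hgc : Continuous fun s => E s + d / E s := hEc.add (continuous_const.div hEc hE0)
  have hμE : E (μ.arg / Real.pi) = μ := by
    have h := Complex.norm_mul_exp_arg_mul_I μ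
    rw [hμ] at h
    simp only [hE]
    push_cast
    rw [mul_div_cancel₀ _ (by exact_mod_cast Real.pi_ne_zero)]
    simpa using h
  obtain ⟨ε, hε, hball⟩ := Metric.isOpen_iff.1 (hW.preimage hgc) (μ.arg / Real.pi)
    (by simpa [hμE] using hmem)
  set s₀ := μ.arg / Real.pi
  have hbad (q : ℝ) (h : E q = d / E q) : ∃ n : ℤ, 2 * q = n := by
    rw [eq_div_iff (hE0 q)] at h
    have h4 : E q ^ 4 = 1 := by
      rw [show E q ^ 4 = (E q * E q) ^ 2 by ring, h]
      rcases hd with rfl | rfl <;> norm_num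
    rw [hE, ← Complex.exp_nat_mul, Complex.exp_eq_one_iff] at h4
    obtain ⟨n, hn⟩ := h4
    refine ⟨n, ?_⟩
    have hpi : (Real.pi : ℂ) ≠ 0 := by exact_mod_cast Real.pi_ne_zero
    have : (2 * q : ℂ) = n := by
      refine mul_left_cancel₀ (mul_ne_zero (mul_ne_zero two_ne_zero hpi) Complex.I_ne_zero) ?_
      push_cast at hn
      linear_combination hn
    exact_mod_cast this
  obtain ⟨q, hq, hqne⟩ : ∃ q : ℚ, (q : ℝ) ∈ Metric.ball s₀ ε ∧ E q ≠ d / E q := by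
    have hδ : 0 < min ε (1 / 4) := lt_min hε (by norm_num)
    obtain ⟨q₁, h1, h1'⟩ := exists_rat_btwn (lt_add_of_pos_right s₀ hδ)
    obtain ⟨q₂, h2, h2'⟩ := exists_rat_btwn h1'
    have hε' := min_le_left ε (1 / 4)
    have hε'' := min_le_right ε (1 / 4)
    have hin (q : ℝ) (h : s₀ < q) (h' : q < s₀ + min ε (1 / 4)) : q ∈ Metric.ball s₀ ε := by
      rw [Metric.mem_ball, Real.dist_eq, abs_lt]
      constructor <;> linarith
    by_cases hb : E q₁ = d / E q₁
    · refine ⟨q₂, hin _ (h1.trans h2) h2', fun hb' => ?_⟩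
      obtain ⟨n₁, hn₁⟩ := hbad _ hb
      obtain ⟨n₂, hn₂⟩ := hbad _ hb'
      have ha : (n₁ : ℝ) < n₂ := by linarith
      have hc : (n₂ : ℝ) < n₁ + 1 := by linarith
      have ha' : n₁ < n₂ := by exact_mod_cast ha
      have hc' : n₂ < n₁ + 1 := by exact_mod_cast hc
      omega
    · exact ⟨q₁, hin _ h1 h1', hb⟩
  have hden := q.den_pos
  have hpow : E q ^ (4 * q.den) = 1 := by
    rw [hE, ← Complex.exp_nat_mul, Complex.exp_eq_one_iff]
    refine ⟨2 * q.num, ?_⟩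
    have hq' : (q : ℂ) * q.den = q.num := by exact_mod_cast Rat.mul_den_eq_num q
    push_cast
    linear_combination (4 * Real.pi * Complex.I) * hq'
  refine ⟨E q, 4 * q.den, by omega, hE0 _, hqne, ?_, hball hq⟩
  rw [div_pow, hpow, div_one, pow_mul]
  rcases hd with rfl | rfl <;> norm_num

lemma mem_sigmaInf_of_discriminant {B K : ℤ → ℂ} {m : ℕ} (hm : 1 ≤ m)
    (hB : ∀ j, B (j + m) = B j) (hK : ∀ j, K (j + m) = K j)
    (hB1 : ∀ j, B j = 1 ∨ B j = -1) (hK1 : ∀ j, K j = 1 ∨ K j = -1) {lam μ ν : ℂ}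
    (hτ : (discriminant B K m 0).eval lam = μ + ν)
    (hd : ∏ i ∈ Finset.range m, B (0 + i) * K (0 + i - 1) = μ * ν) (hne : μ ≠ ν) {N : ℕ}
    (hN4 : 4 ≤ N) (hN : μ ^ N = ν ^ N) : lam ∈ sigmaInf := by
  have hNm : 4 ≤ N * m := hN4.trans (Nat.le_mul_of_pos_right N hm)
  refine ⟨N * m - 2, by omega, fun i => K i, fun i => B i, fun i _ => hK1 i, fun i _ => hB1 i, ?_⟩
  rw [mem_spectrum_afin_iff]
  refine ⟨solution (fun n => B (0 + n)) (fun n => B (0 + n) * K (0 + n - 1)) lam, rfl, ?_,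
    ⟨0, Nat.zero_le _, one_ne_zero⟩, fun i _ => ?_⟩
  · rw [Nat.sub_add_cancel (by omega)]
    refine solution_eq_zero (fun n => ?_) (fun n => ?_) hτ hd hne hN
    · rw [Nat.cast_add, ← add_assoc, hB]
    · rw [Nat.cast_add, ← add_assoc, hB, add_sub_right_comm, hK]
  · have hBB : B i * B i = 1 := by rcases hB1 i with h | h <;> simp [h]
    rw [solution, zero_add]
    rcases Nat.eq_zero_or_pos i with rfl | hi
    · simp only [solution]
      linear_combination lam * hBB
    · rw [Nat.cast_sub hi, Nat.cast_one]
      linear_combination (lam * solution (fun n => B (0 + n)) (fun n => B (0 + n) * K (0 + n - 1))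
        lam (i + 1) - K (i - 1) * solution (fun n => B (0 + n))
          (fun n => B (0 + n) * K (0 + n - 1)) lam i) * hBB

/-- The `m`-periodic extension to `ℤ` of the first `m` values of `f`. -/
def periodize {α : Type*} (m : ℕ) (f : ℕ → α) (j : ℤ) : α := f (j % (m : ℤ)).toNat

lemma periodize_add {α : Type*} (m : ℕ) (f : ℕ → α) (j : ℤ) :
    periodize m f (j + m) = periodize m f j := by
  simp [periodize]

lemma periodize_mem {α : Type*} {m : ℕ} (hm : 1 ≤ m) {f : ℕ → α} {p : α → Prop}
    (hf : ∀ i < m, p (f i)) (j : ℤ) : p (periodize m f j) := by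
  have h1 := Int.emod_nonneg j (by omega : (m : ℤ) ≠ 0)
  have h2 := Int.emod_lt_of_pos j (by omega : (0 : ℤ) < m)
  exact hf _ (by omega)

lemma piInf_subset_closure_sigmaInf : piInf ⊆ closure sigmaInf := by
  rintro lam ⟨m, hm, k, l, hk, hl, T, hT, hlam⟩
  set B : ℤ → ℂ := periodize m l
  set K : ℤ → ℂ := periodize m k
  have hB : ∀ j, B (j + m) = B j := periodize_add m l
  have hK : ∀ j, K (j + m) = K j := periodize_add m k
  have hB1 : ∀ j, B j = 1 ∨ B j = -1 := periodize_mem (p := fun z => z = 1 ∨ z = -1) hm hl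
  have hK1 : ∀ j, K j = 1 ∨ K j = -1 := periodize_mem (p := fun z => z = 1 ∨ z = -1) hm hk
  obtain ⟨μ, hμ, hval⟩ := exists_unimodular_eval_discriminant hB hK hB1 hK1 hT hlam
  set d : ℂ := ∏ i ∈ Finset.range m, B (0 + i) * K (0 + i - 1) with hd
  have hd1 : d = 1 ∨ d = -1 := by
    refine Finset.prod_induction _ (fun z : ℂ => z = 1 ∨ z = -1) ?_ (Or.inl rfl) fun i _ => ?_
    · rintro a b (rfl | rfl) (rfl | rfl) <;> simp
    · rcases hB1 (0 + i) with h | h <;> rcases hK1 (0 + i - 1) with h' | h' <;>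
        rw [h, h'] <;> simp
  have hopen : IsOpenMap fun z => (discriminant B K m 0).eval z := by
    have han : AnalyticOnNhd ℂ (fun z => (discriminant B K m 0).eval z) Set.univ :=
      fun z _ => AnalyticAt.aeval_polynomial analyticAt_id _
    refine han.is_constant_or_isOpenMap.resolve_left ?_
    rintro ⟨w, hw⟩
    have hC : discriminant B K m 0 = C w := Polynomial.funext fun z => by rw [hw, eval_C]
    have hdeg := degree_trace_transfer (b := fun n : ℕ => B (0 + n))
      (fun n : ℕ => B (0 + n) * K (0 + n - 1))
      (fun n => by rcases hB1 (0 + n) with h | h <;> rw [h] <;> simp) hm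
    have hle : ((m : ℕ) : WithBot ℕ) ≤ 0 := by
      rw [← hdeg]
      exact (congrArg degree hC).trans_le degree_C_le
    have : m ≤ 0 := by exact_mod_cast hle
    omega
  rw [mem_closure_iff]
  intro O hO hlamO
  obtain ⟨ν, N, hN4, hν0, hne, hN, z, hzO, hz⟩ := exists_rootOfUnity_near hd1 hμ (hopen O hO)
    ⟨lam, hlamO, hval⟩
  exact ⟨z, hzO, mem_sigmaInf_of_discriminant hm hB hK hB1 hK1 hz
    (by rw [mul_div_cancel₀ _ hν0]) hne hN4 hN⟩

/-- A bounded eigenfunction of a periodic operator which vanishes periodically certifies a point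
of the `ℓ²` spectrum. -/
lemma mem_spectrum_of_periodic_eigenfunction {B K : ℤ → ℂ} {m : ℕ} (hm : 1 ≤ m)
    (hBn : ∀ j, ‖B j‖ = 1) (hKn : ∀ j, ‖K j‖ = 1) {T : EllTwo →L[ℂ] EllTwo}
    (hT : ∀ (x : EllTwo) (j : ℤ), T x j = B j * x (j + 1) + K (j - 1) * x (j - 1))
    {v : ℤ → ℂ} (hv : Function.Periodic v m) (hv0 : v 0 = 0) {a : ℕ} (ha : a < m)
    (hva : v a ≠ 0) {lam : ℂ}
    (heq : ∀ j, B j * v (j + 1) + K (j - 1) * v (j - 1) = lam * v j) :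
    lam ∈ spectrum ℂ T := by
  have h2 : (0 : ℝ) < (2 : ENNReal).toReal := by simp
  rw [spectrum.mem_iff]
  rintro ⟨U, hU⟩
  set G : EllTwo →L[ℂ] EllTwo := ((U⁻¹ : (EllTwo →L[ℂ] EllTwo)ˣ) : EllTwo →L[ℂ] EllTwo)
  have hGU (x : EllTwo) : G ((algebraMap ℂ (EllTwo →L[ℂ] EllTwo) lam - T) x) = x := by
    rw [← hU]
    exact congrArg (fun A : EllTwo →L[ℂ] EllTwo => A x) U.inv_mul
  set c := ‖G‖ * (‖v (-1)‖ + ‖v 1‖)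
  have hbound (R : ℕ) (hR : 1 ≤ R) : R * ‖v a‖ ^ (2 : ENNReal).toReal ≤
      c ^ (2 : ENNReal).toReal := by
    have hvR (j : ℤ) : v (j + R * m) = v j := hv.int_mul R j
    have hRm : (0 : ℤ) < R * m := by positivity
    set y : EllTwo := ⟨fun j => if 0 ≤ j ∧ j ≤ R * m then v j else 0, memℓp_gen
      (summable_of_ne_finset_zero (s := Finset.Icc 0 (R * m : ℤ)) fun j hj => by
        rw [Finset.mem_Icc] at hj
        simp [hj])⟩
    have hyj (j : ℤ) : y j = if 0 ≤ j ∧ j ≤ R * m then v j else 0 := rfl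
    have hTy : (algebraMap ℂ (EllTwo →L[ℂ] EllTwo) lam - T) y =
        lp.single 2 (0 : ℤ) (K (-1) * v (-1)) + lp.single 2 (R * m : ℤ) (B (R * m) * v 1) := by
      ext j
      have hl : ((algebraMap ℂ (EllTwo →L[ℂ] EllTwo) lam - T) y) j =
        lam * y j - T y j := rfl
      have hr : (lp.single 2 (0 : ℤ) (K (-1) * v (-1)) +
          lp.single 2 (R * m : ℤ) (B (R * m) * v 1) : EllTwo) j =
          (if j = 0 then K (-1) * v (-1) else 0) +
            (if j = R * m then B (R * m) * v 1 else 0) := by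
        rw [lp.coeFn_add, Pi.add_apply, lp.single_apply, lp.single_apply]
        congr 1 <;> simp [Pi.single_apply]
      rw [hl, hr, hT, hyj, hyj, hyj]
      have hvRm : v (R * m) = 0 := by simpa [hv0] using hvR 0
      have hvRm1 : v (R * m + 1) = v 1 := by rw [add_comm]; exact hvR 1
      have hj := heq j
      rcases lt_trichotomy j 0 with h | rfl | h
      · rw [if_neg (by omega : ¬(0 ≤ j ∧ j ≤ (R * m : ℤ))),
          if_neg (by omega : ¬(0 ≤ j - 1 ∧ j - 1 ≤ (R * m : ℤ))), if_neg (by omega : ¬ j = 0),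
          if_neg (by omega : ¬ j = (R * m : ℤ))]
        split_ifs with h'
        · rw [show j + 1 = 0 by omega, hv0]; ring
        · ring
      · rw [if_pos (by omega), if_pos (by omega), if_neg (by omega), if_pos rfl,
          if_neg (by omega)]
        simp only [zero_sub] at hj
        linear_combination -hj
      · rw [if_neg (by omega : ¬ j = 0)]
        rcases lt_trichotomy j (R * m) with h' | rfl | h'
        · rw [if_pos (by omega), if_pos (by omega), if_pos (by omega), if_neg (by omega)]
          linear_combination -hj
        · rw [if_pos (by omega), if_neg (by omega), if_pos (by omega), if_pos rfl]
          rw [hvRm1] at hj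
          linear_combination -hj
        · rw [if_neg (by omega), if_neg (by omega : ¬(_ ∧ j + 1 ≤ _)),
            if_neg (by omega : ¬ j = R * m)]
          split_ifs with h''
          · rw [show j - 1 = R * m by omega, hvRm]; ring
          · ring
    have hnorm : ‖(algebraMap ℂ (EllTwo →L[ℂ] EllTwo) lam - T) y‖ ≤ ‖v (-1)‖ + ‖v 1‖ := by
      rw [hTy]
      refine (norm_add_le _ _).trans_eq ?_
      rw [lp.norm_single (by simp), lp.norm_single (by simp), norm_mul, norm_mul, hBn, hKn,
        one_mul, one_mul]
    have hyn : ‖y‖ ≤ c := by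
      calc ‖y‖ = ‖G ((algebraMap ℂ (EllTwo →L[ℂ] EllTwo) lam - T) y)‖ := by rw [hGU]
        _ ≤ ‖G‖ * ‖(algebraMap ℂ (EllTwo →L[ℂ] EllTwo) lam - T) y‖ := G.le_opNorm _
        _ ≤ c := mul_le_mul_of_nonneg_left hnorm (norm_nonneg _)
    have hinj : Function.Injective fun r : ℕ => (a + r * m : ℤ) := fun r s hrs => by
      have hm0 : (m : ℤ) ≠ 0 := by omega
      have : (r : ℤ) * m = s * m := by simpa using hrs
      exact_mod_cast mul_right_cancel₀ hm0 this
    have hsum : ∑ r ∈ Finset.range R, ‖y (a + r * m : ℤ)‖ ^ (2 : ENNReal).toReal ≤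
        ‖y‖ ^ (2 : ENNReal).toReal := by
      have h := lp.sum_rpow_le_norm_rpow h2 y ((Finset.range R).map ⟨_, hinj⟩)
      rw [Finset.sum_map] at h
      exact h
    have hterm : ∀ r ∈ Finset.range R,
        ‖y (a + r * m : ℤ)‖ ^ (2 : ENNReal).toReal = ‖v a‖ ^ (2 : ENNReal).toReal := by
      intro r hr
      have hrR : r + 1 ≤ R := Finset.mem_range.1 hr
      have hle : (a + r * m : ℤ) ≤ R * m := by
        have : (r + 1) * m ≤ R * m := Nat.mul_le_mul_right m hrR
        have h' : a + r * m ≤ R * m := by linarith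
        exact_mod_cast h'
      have hva' : v (a + r * m) = v a := hv.int_mul r a
      rw [hyj, if_pos ⟨by positivity, hle⟩, hva']
    rw [Finset.sum_congr rfl hterm, Finset.sum_const, Finset.card_range, nsmul_eq_mul] at hsum
    exact hsum.trans (Real.rpow_le_rpow (norm_nonneg _) hyn h2.le)
  have hpos : 0 < ‖v a‖ ^ (2 : ENNReal).toReal := Real.rpow_pos_of_pos (norm_pos_iff.2 hva) _
  obtain ⟨R, hR⟩ := exists_nat_gt (c ^ (2 : ENNReal).toReal / ‖v a‖ ^ (2 : ENNReal).toReal)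
  rw [div_lt_iff₀ hpos] at hR
  have h1 := hbound (R + 1) (by omega)
  push_cast at h1
  linarith

lemma periodize_add_one {α : Type*} {m : ℕ} (hm : 1 ≤ m) (f : ℕ → α) (j : ℤ) :
    periodize m f (j + 1) =
      if (j % (m : ℤ)).toNat + 1 = m then f 0 else f ((j % (m : ℤ)).toNat + 1) := by
  have h1 := Int.emod_nonneg j (by omega : (m : ℤ) ≠ 0)
  have h2 := Int.emod_lt_of_pos j (by omega : (0 : ℤ) < m)
  rw [periodize, ← Int.emod_add_emod]
  split_ifs with h
  · rw [show j % (m : ℤ) + 1 = m by omega, Int.emod_self]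
    rfl
  · rw [Int.emod_eq_of_lt (by omega) (by omega)]
    congr 1
    omega

lemma periodize_sub_one {α : Type*} {m : ℕ} (hm : 1 ≤ m) (f : ℕ → α) (j : ℤ) :
    periodize m f (j - 1) =
      if (j % (m : ℤ)).toNat = 0 then f (m - 1) else f ((j % (m : ℤ)).toNat - 1) := by
  have h1 := Int.emod_nonneg j (by omega : (m : ℤ) ≠ 0)
  have h2 := Int.emod_lt_of_pos j (by omega : (0 : ℤ) < m)
  rw [periodize, ← Int.emod_sub_emod]
  split_ifs with h
  · rw [show j % (m : ℤ) - 1 = m - 1 + m * (-1) by omega, Int.add_mul_emod_self_left,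
      Int.emod_eq_of_lt (by omega) (by omega)]
    congr 1
    omega
  · rw [Int.emod_eq_of_lt (by omega) (by omega)]
    congr 1
    omega

/-- Coefficients of the operator obtained by reflecting a finite tridiagonal matrix: `f` on the
original block, the reversal of `g` on the mirrored block, and `c` elsewhere. -/
def reflect (n : ℕ) (f g : ℕ → ℂ) (c : ℂ) (p : ℕ) : ℂ :=
  if 1 ≤ p ∧ p ≤ n then f (p - 1)
  else if n + 3 ≤ p ∧ p ≤ 2 * n + 2 then g (2 * n + 2 - p) else c

lemma reflect_mem {n : ℕ} {f g : ℕ → ℂ} {c : ℂ} (hf : ∀ i < n, f i = 1 ∨ f i = -1)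
    (hg : ∀ i < n, g i = 1 ∨ g i = -1) (hc : c = 1 ∨ c = -1) (p : ℕ) :
    reflect n f g c p = 1 ∨ reflect n f g c p = -1 := by
  rw [reflect]
  split_ifs
  · exact hf _ (by omega)
  · exact hg _ (by omega)
  · exact hc

lemma reflect_eigen {n : ℕ} {k l u : ℕ → ℂ} {lam : ℂ} (h0 : u 0 = 0) (hn : u (n + 2) = 0)
    (hrec : ∀ i ≤ n, l i * u (i + 2) + k (i - 1) * u i = lam * u (i + 1)) (j : ℤ) :
    periodize (2 * n + 4) (reflect n l k 1) j *
        periodize (2 * n + 4) (fun p => u (min p (2 * n + 4 - p))) (j + 1) +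
      periodize (2 * n + 4) (reflect n k l (-1)) (j - 1) *
        periodize (2 * n + 4) (fun p => u (min p (2 * n + 4 - p))) (j - 1) =
      lam * periodize (2 * n + 4) (fun p => u (min p (2 * n + 4 - p))) j := by
  have hm : 1 ≤ 2 * n + 4 := by omega
  rw [periodize_add_one hm, periodize_sub_one hm, periodize_sub_one hm, periodize, periodize]
  have h1 := Int.emod_nonneg j (by omega : ((2 * n + 4 : ℕ) : ℤ) ≠ 0)
  have h2 := Int.emod_lt_of_pos j (by omega : (0 : ℤ) < ((2 * n + 4 : ℕ) : ℤ))
  have hp : (j % ((2 * n + 4 : ℕ) : ℤ)).toNat < 2 * n + 4 := by omega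
  generalize (j % ((2 * n + 4 : ℕ) : ℤ)).toNat = p at hp
  rcases Nat.eq_zero_or_pos p with rfl | hp0
  · rw [if_neg (by omega), if_pos rfl, if_pos rfl, reflect, if_neg (by omega), if_neg (by omega),
      reflect, if_neg (by omega), if_neg (by omega), min_eq_left (by omega),
      min_eq_right (by omega), min_eq_left (by omega), h0,
      show 2 * n + 4 - (2 * n + 4 - 1) = 0 + 1 by omega]
    ring
  rw [if_neg hp0.ne', if_neg hp0.ne']
  rcases lt_trichotomy p (n + 2) with h | rfl | h
  · obtain ⟨i, rfl⟩ : ∃ i, p = i + 1 := ⟨p - 1, by omega⟩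
    rw [if_neg (by omega), min_eq_left (by omega), min_eq_left (by omega),
      min_eq_left (by omega), Nat.add_sub_cancel, ← hrec i (by omega)]
    congr 1
    · by_cases hi : i + 1 ≤ n
      · rw [reflect, if_pos ⟨by omega, hi⟩, Nat.add_sub_cancel]
      · rw [show i + 1 + 1 = n + 2 by omega, hn, mul_zero, mul_zero]
    · by_cases hi : 1 ≤ i
      · rw [reflect, if_pos ⟨hi, by omega⟩]
      · rw [show i = 0 by omega, h0, mul_zero, mul_zero]
  · rw [if_neg (by omega), reflect, if_neg (by omega), if_neg (by omega),
      reflect, if_neg (by omega), if_neg (by omega), min_eq_right (by omega),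
      min_eq_left (by omega), min_eq_left (by omega), hn,
      show 2 * n + 4 - (n + 2 + 1) = n + 2 - 1 by omega]
    ring
  · obtain ⟨i, hi⟩ : ∃ i, p + (i + 1) = 2 * n + 4 := ⟨2 * n + 4 - p - 1, by omega⟩
    have hnext : (if p + 1 = 2 * n + 4 then u (min 0 (2 * n + 4 - 0))
        else u (min (p + 1) (2 * n + 4 - (p + 1)))) = u i := by
      split_ifs
      · congr 1; omega
      · congr 1; omega
    rw [hnext, show min (p - 1) (2 * n + 4 - (p - 1)) = i + 2 by omega,
      show min p (2 * n + 4 - p) = i + 1 by omega, ← hrec i (by omega), add_comm]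
    congr 1
    · by_cases hi' : i = n
      · rw [hi', hn, mul_zero, mul_zero]
      · rw [reflect, if_neg (by omega), if_pos (by omega),
          show 2 * n + 2 - (p - 1) = i by omega]
    · by_cases hi' : i = 0
      · rw [hi', h0, mul_zero, mul_zero]
      · rw [reflect, if_neg (by omega), if_pos (by omega),
          show 2 * n + 2 - p = i - 1 by omega]

lemma sigmaInf_subset_piInf : sigmaInf ⊆ piInf := by
  rintro lam ⟨n, -, k, l, hk, hl, hlam⟩
  obtain ⟨u, h0, hn, ⟨i, hi, hne⟩, hrec⟩ := mem_spectrum_afin_iff.1 hlam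
  have hm : 1 ≤ 2 * n + 4 := by omega
  have hk' := reflect_mem hk hl (Or.inr rfl : (-1 : ℂ) = 1 ∨ (-1 : ℂ) = -1)
  have hl' := reflect_mem hl hk (Or.inl rfl : (1 : ℂ) = 1 ∨ (1 : ℂ) = -1)
  have hnorm {f : ℕ → ℂ} (hf : ∀ p, f p = 1 ∨ f p = -1) (j : ℤ) :
      ‖periodize (2 * n + 4) f j‖ = 1 := by
    rcases hf (j % ((2 * n + 4 : ℕ) : ℤ)).toNat with h | h <;> rw [periodize, h] <;> simp
  set B := periodize (2 * n + 4) (reflect n l k 1)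
  set K := periodize (2 * n + 4) (reflect n k l (-1))
  set T : EllTwo →L[ℂ] EllTwo := (weightedShift B (hnorm hl') 1).toContinuousLinearMap +
    (weightedShift (fun j => K (j - 1)) (fun j => hnorm hk' (j - 1)) (-1)).toContinuousLinearMap
  have hT (x : EllTwo) (j : ℤ) : T x j = B j * x (j + 1) + K (j - 1) * x (j - 1) := rfl
  refine ⟨2 * n + 4, hm, reflect n k l (-1), reflect n l k 1, fun p _ => hk' p, fun p _ => hl' p,
    T, hT, ?_⟩
  have hpi : (((i + 1 : ℕ) : ℤ) % ((2 * n + 4 : ℕ) : ℤ)).toNat = i + 1 := by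
    rw [Int.emod_eq_of_lt (by omega) (by omega)]
    rfl
  refine mem_spectrum_of_periodic_eigenfunction hm (hnorm hl') (hnorm hk') hT
    (v := periodize (2 * n + 4) fun p => u (min p (2 * n + 4 - p)))
    (periodize_add _ _) ?_ (a := i + 1) (by omega) ?_ (reflect_eigen h0 hn hrec)
  · simpa [periodize] using h0
  · rw [periodize, hpi, min_eq_left (by omega)]
    exact hne

end TridiagonalSign

/-- main theorem: `σ∞ ⊆ π∞` and `π∞ ⊆ closure σ∞`; that is, the set of
eigenvalues of finite tridiagonal sign matrices is a dense subset of the union of spectra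
of periodic tridiagonal sign operators. -/
theorem sigmaInf_dense_subset_piInf : sigmaInf ⊆ piInf ∧ piInf ⊆ closure sigmaInf := by
  exact ⟨TridiagonalSign.sigmaInf_subset_piInf, TridiagonalSign.piInf_subset_closure_sigmaInf⟩
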